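/- Let X be a GC_5 set of 21 nodes with no maximal line, and suppose a 3-node line ℓ̃ is used by two distinct nodes A, B ∈ X. Then there exists a third node C ∈ X using ℓ̃; moreover A, B, C share three further common used lines, each passing through five primary nodes, the m-d sequence of each of A, B, C is (5,5,5,3,2), and ℓ̃ is used by exactly three nodes of X. -/

import Mathlib

open MvPolynomial

/-- Evaluation of a bivariate polynomial at a point of the real plane. -/
noncomputable def ev (p : MvPolynomial (Fin 2) ℝ) (A : ℝ × ℝ) : ℝ :=
  MvPolynomial.eval ![A.1, A.2] p

/-- A polynomial of total degree exactly 1, defining a line. -/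
def IsLinePoly (l : MvPolynomial (Fin 2) ℝ) : Prop := l.totalDegree = 1

/-- The line (zero set) defined by a polynomial. -/
def lineSet (l : MvPolynomial (Fin 2) ℝ) : Set (ℝ × ℝ) := {A | ev l A = 0}

/-- The number of nodes of `X` lying on the line defined by `l`. -/
noncomputable def nodesOn (X : Set (ℝ × ℝ)) (l : MvPolynomial (Fin 2) ℝ) : ℕ :=
  (X ∩ lineSet l).ncard

/-- `X` is an `n`-poised set: it has `N = (n+2)(n+1)/2` nodes and the only polynomial of
degree ≤ n vanishing on all of `X` is the zero polynomial. -/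
def Poised (n : ℕ) (X : Set (ℝ × ℝ)) : Prop :=
  X.Finite ∧ X.ncard = (n + 2) * (n + 1) / 2 ∧
    ∀ p : MvPolynomial (Fin 2) ℝ, p.totalDegree ≤ n → (∀ A ∈ X, ev p A = 0) → p = 0

/-- `p` is an `n`-fundamental polynomial of the node `A` with respect to `X`. -/
def IsFund (n : ℕ) (X : Set (ℝ × ℝ)) (A : ℝ × ℝ) (p : MvPolynomial (Fin 2) ℝ) : Prop :=
  p.totalDegree ≤ n ∧ ev p A = 1 ∧ ∀ B ∈ X, B ≠ A → ev p B = 0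

/-- `X` is a `GC_n` set: it is `n`-poised and each fundamental polynomial is a product of
`n` linear (degree-1) polynomials. -/
def GCSet (n : ℕ) (X : Set (ℝ × ℝ)) : Prop :=
  Poised n X ∧ ∀ A ∈ X, ∃ p : MvPolynomial (Fin 2) ℝ, IsFund n X A p ∧
    ∃ f : Fin n → MvPolynomial (Fin 2) ℝ, (∀ i, IsLinePoly (f i)) ∧ p = ∏ i, f i

/-- The node `A` uses the line `l`: the linear polynomial `l` divides a fundamental
polynomial of `A`. -/
def Uses (n : ℕ) (X : Set (ℝ × ℝ)) (A : ℝ × ℝ) (l : MvPolynomial (Fin 2) ℝ) : Prop :=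
  ∃ p, IsFund n X A p ∧ l ∣ p

/-- `X` has no maximal line, i.e. no line passes through `n+1` nodes of `X`. -/
def NoMaximalLine (n : ℕ) (X : Set (ℝ × ℝ)) : Prop :=
  ∀ l : MvPolynomial (Fin 2) ℝ, IsLinePoly l → nodesOn X l ≠ n + 1

/-- Number of nodes of `X` on the line `l` which do not lie on any of the lines
`L 0, …, L (s-1)` (the primary node count of `l` at step `s`). -/
noncomputable def resCount (X : Set (ℝ × ℝ)) (L : Fin 5 → MvPolynomial (Fin 2) ℝ)
    (s : Fin 5) (l : MvPolynomial (Fin 2) ℝ) : ℕ :=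
  {B ∈ X | ev l B = 0 ∧ ∀ i : Fin 5, i < s → ev (L i) B ≠ 0}.ncard

/-- `L` is an m-line sequence of the node `A` of the `GC_5` set `X`: it enumerates the five
distinct used lines of `A` (a fundamental polynomial of `A` is, up to a constant, the
product of the `L i`), ordered greedily: at each step `s` the line `L s` has maximal
primary node count among the remaining used lines. -/
def MLineSeq (X : Set (ℝ × ℝ)) (A : ℝ × ℝ) (L : Fin 5 → MvPolynomial (Fin 2) ℝ) : Prop :=
  (∀ i, IsLinePoly (L i)) ∧
  (∀ i j : Fin 5, i ≠ j → lineSet (L i) ≠ lineSet (L j)) ∧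
  (∃ p : MvPolynomial (Fin 2) ℝ, IsFund 5 X A p ∧ ∃ c : ℝ, p = MvPolynomial.C c * ∏ i, L i) ∧
  (∀ s t : Fin 5, s ≤ t → resCount X L s (L t) ≤ resCount X L s (L s))

/-- The node `A` has m-distribution sequence `k`. -/
def HasMDSeq (X : Set (ℝ × ℝ)) (A : ℝ × ℝ) (k : Fin 5 → ℕ) : Prop :=
  ∃ L : Fin 5 → MvPolynomial (Fin 2) ℝ, MLineSeq X A L ∧ ∀ s, resCount X L s (L s) = k s

/-- The polynomial `a x + b y + c`. -/
noncomputable def linPoly (a b c : ℝ) : MvPolynomial (Fin 2) ℝ :=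
  C a * X 0 + C b * X 1 + C c

/-- A point set which is a line of the plane. -/
def IsLine (s : Set (ℝ × ℝ)) : Prop := ∃ l, IsLinePoly l ∧ lineSet l = s

lemma ev_mul (p q : MvPolynomial (Fin 2) ℝ) (A : ℝ × ℝ) : ev (p * q) A = ev p A * ev q A :=
  map_mul _ _ _

lemma ev_add (p q : MvPolynomial (Fin 2) ℝ) (A : ℝ × ℝ) : ev (p + q) A = ev p A + ev q A :=
  map_add _ _ _

lemma ev_sub (p q : MvPolynomial (Fin 2) ℝ) (A : ℝ × ℝ) : ev (p - q) A = ev p A - ev q A :=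
  map_sub _ _ _

lemma ev_C (c : ℝ) (A : ℝ × ℝ) : ev (C c) A = c := by simp [ev]

lemma ev_prod {ι : Type*} (s : Finset ι) (f : ι → MvPolynomial (Fin 2) ℝ) (A : ℝ × ℝ) :
    ev (∏ i ∈ s, f i) A = ∏ i ∈ s, ev (f i) A :=
  map_prod _ _ _

lemma ev_linPoly (a b c : ℝ) (A : ℝ × ℝ) : ev (linPoly a b c) A = a * A.1 + b * A.2 + c := by
  simp [ev, linPoly]

lemma mem_lineSet {l : MvPolynomial (Fin 2) ℝ} {A : ℝ × ℝ} : A ∈ lineSet l ↔ ev l A = 0 :=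
  Iff.rfl

lemma coeff_linPoly_zero (a b c : ℝ) : coeff 0 (linPoly a b c) = c := by
  simp [linPoly, coeff_C_mul, coeff_X]

lemma coeff_linPoly_x (a b c : ℝ) : coeff (Finsupp.single 0 1) (linPoly a b c) = a := by
  have h : (0 : Fin 2 →₀ ℕ) ≠ Finsupp.single 0 1 := by simp [eq_comm]
  simp [linPoly, coeff_C_mul, coeff_X, coeff_C, Finsupp.single_left_inj, h]

lemma coeff_linPoly_y (a b c : ℝ) : coeff (Finsupp.single 1 1) (linPoly a b c) = b := by
  have h : (0 : Fin 2 →₀ ℕ) ≠ Finsupp.single 1 1 := by simp [eq_comm]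
  simp [linPoly, coeff_C_mul, coeff_X, coeff_C, Finsupp.single_left_inj, h]

lemma totalDegree_linPoly_le (a b c : ℝ) : (linPoly a b c).totalDegree ≤ 1 := by
  have h (t : ℝ) (i : Fin 2) : (C t * X i : MvPolynomial (Fin 2) ℝ).totalDegree ≤ 1 :=
    (totalDegree_mul _ _).trans (by simp)
  refine (totalDegree_add _ _).trans (max_le ((totalDegree_add _ _).trans (max_le ?_ ?_)) ?_)
  · exact h a 0
  · exact h b 1
  · simp

lemma eq_linPoly_of_totalDegree_le {p : MvPolynomial (Fin 2) ℝ} (h : p.totalDegree ≤ 1) :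
    ∃ a b c, p = linPoly a b c := by
  refine ⟨coeff (Finsupp.single 0 1) p, coeff (Finsupp.single 1 1) p, coeff 0 p, ?_⟩
  ext m
  by_cases hm : 1 < m.degree
  · rw [coeff_eq_zero_of_totalDegree_lt (lt_of_le_of_lt h hm),
      coeff_eq_zero_of_totalDegree_lt
        (lt_of_le_of_lt (totalDegree_linPoly_le _ _ _) hm)]
  · have hs : m 0 + m 1 ≤ 1 := by
      simpa [Finsupp.degree_eq_sum] using hm
    obtain ⟨h0, h1⟩ | ⟨h0, h1⟩ | ⟨h0, h1⟩ :
        (m 0 = 0 ∧ m 1 = 0) ∨ (m 0 = 1 ∧ m 1 = 0) ∨ (m 0 = 0 ∧ m 1 = 1) := by omega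
    · obtain rfl : m = 0 := by ext i; fin_cases i <;> simp [h0, h1]
      rw [coeff_linPoly_zero]
    · obtain rfl : m = Finsupp.single 0 1 := by ext i; fin_cases i <;> simp [h0, h1]
      rw [coeff_linPoly_x]
    · obtain rfl : m = Finsupp.single 1 1 := by ext i; fin_cases i <;> simp [h0, h1]
      rw [coeff_linPoly_y]

lemma isLinePoly_linPoly {a b c : ℝ} (h : a ≠ 0 ∨ b ≠ 0) : IsLinePoly (linPoly a b c) := by
  refine le_antisymm (totalDegree_linPoly_le a b c) ?_
  obtain h | h := h
  · simpa using le_totalDegree (p := linPoly a b c) (s := Finsupp.single 0 1)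
      (by simpa [coeff_linPoly_x] using h)
  · simpa using le_totalDegree (p := linPoly a b c) (s := Finsupp.single 1 1)
      (by simpa [coeff_linPoly_y] using h)

lemma IsLinePoly.exists_eq_linPoly {l : MvPolynomial (Fin 2) ℝ} (h : IsLinePoly l) :
    ∃ a b c, (a ≠ 0 ∨ b ≠ 0) ∧ l = linPoly a b c := by
  obtain ⟨a, b, c, rfl⟩ := eq_linPoly_of_totalDegree_le h.le
  refine ⟨a, b, c, ?_, rfl⟩
  by_contra! hab
  simp [IsLinePoly, linPoly, hab.1, hab.2] at h

lemma IsLinePoly.ne_zero {l : MvPolynomial (Fin 2) ℝ} (h : IsLinePoly l) : l ≠ 0 := by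
  rintro rfl
  simp [IsLinePoly] at h

lemma IsLinePoly.prime {l : MvPolynomial (Fin 2) ℝ} (h : IsLinePoly l) : Prime l := by
  refine (irreducible_of_totalDegree_eq_one h fun x hx => ?_).prime
  rw [isUnit_iff_ne_zero]
  rintro rfl
  exact h.ne_zero (MvPolynomial.ext _ _ fun m => by simpa using hx m)

lemma IsLinePoly.lineSet_eq_of_dvd {l m : MvPolynomial (Fin 2) ℝ} (hl : IsLinePoly l)
    (hm0 : m ≠ 0) (hm : m.totalDegree ≤ 1) (h : l ∣ m) : lineSet m = lineSet l := by
  obtain ⟨q, rfl⟩ := h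
  have hq : q ≠ 0 := right_ne_zero_of_mul hm0
  rw [totalDegree_mul_of_isDomain hl.ne_zero hq, hl] at hm
  have hq' := totalDegree_eq_zero_iff_eq_C.1 (show q.totalDegree = 0 by omega)
  rw [hq'] at hq ⊢
  have hc : coeff 0 q ≠ 0 := fun h0 => hq (by rw [h0, C_0])
  ext P
  simp [mem_lineSet, ev_mul, ev_C, hc]

lemma exists_linePoly_through {P Q : ℝ × ℝ} (h : P ≠ Q) :
    ∃ l, IsLinePoly l ∧ ev l P = 0 ∧ ev l Q = 0 := by
  refine ⟨linPoly (Q.2 - P.2) (P.1 - Q.1) (P.2 * (Q.1 - P.1) - P.1 * (Q.2 - P.2)),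
    isLinePoly_linPoly ?_, ?_, ?_⟩
  · by_contra! h'
    exact h (Prod.ext (by linarith [h'.2]) (by linarith [h'.1]))
  · rw [ev_linPoly]; ring
  · rw [ev_linPoly]; ring

lemma IsLinePoly.mem_lineSet_iff {l : MvPolynomial (Fin 2) ℝ} (hl : IsLinePoly l)
    {P Q R : ℝ × ℝ} (hPQ : P ≠ Q) (hP : P ∈ lineSet l) (hQ : Q ∈ lineSet l) :
    R ∈ lineSet l ↔ (R.1 - P.1) * (Q.2 - P.2) = (R.2 - P.2) * (Q.1 - P.1) := by
  obtain ⟨a, b, c, hab, rfl⟩ := hl.exists_eq_linPoly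
  simp only [mem_lineSet, ev_linPoly] at *
  have hd : a * (Q.1 - P.1) + b * (Q.2 - P.2) = 0 := by linarith
  have hR : a * R.1 + b * R.2 + c = a * (R.1 - P.1) + b * (R.2 - P.2) := by linarith
  rw [hR]
  constructor
  · intro h
    obtain ha | hb := hab
    · apply mul_left_cancel₀ ha
      linear_combination (Q.2 - P.2) * h - (R.2 - P.2) * hd
    · apply mul_left_cancel₀ hb
      linear_combination (R.1 - P.1) * hd - (Q.1 - P.1) * h
  · intro h
    by_cases h1 : Q.1 - P.1 = 0
    · have h2 : Q.2 - P.2 ≠ 0 := fun h2 => hPQ (Prod.ext (by linarith) (by linarith))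
      apply mul_left_cancel₀ h2
      linear_combination a * h + (R.2 - P.2) * hd
    · apply mul_left_cancel₀ h1
      linear_combination (R.1 - P.1) * hd - b * h

lemma IsLine.eq_of_mem {s t : Set (ℝ × ℝ)} (hs : IsLine s) (ht : IsLine t) {P Q : ℝ × ℝ}
    (hPQ : P ≠ Q) (hPs : P ∈ s) (hQs : Q ∈ s) (hPt : P ∈ t) (hQt : Q ∈ t) : s = t := by
  obtain ⟨l, hl, rfl⟩ := hs
  obtain ⟨m, hm, rfl⟩ := ht
  ext R
  rw [hl.mem_lineSet_iff hPQ hPs hQs, hm.mem_lineSet_iff hPQ hPt hQt]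

lemma IsLine.subsingleton_inter {s t : Set (ℝ × ℝ)} (hs : IsLine s) (ht : IsLine t)
    (hst : s ≠ t) : (s ∩ t).Subsingleton := fun P hP Q hQ => by
  by_contra h
  exact hst (hs.eq_of_mem ht h hP.1 hQ.1 hP.2 hQ.2)

lemma IsFund.unique {n : ℕ} {Y : Set (ℝ × ℝ)} (hY : Poised n Y) {A : ℝ × ℝ}
    {p q : MvPolynomial (Fin 2) ℝ} (hp : IsFund n Y A p) (hq : IsFund n Y A q) : p = q := by
  refine sub_eq_zero.1 (hY.2.2 _ ((totalDegree_sub _ _).trans (max_le hp.1 hq.1)) fun B hB => ?_)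
  rw [ev_sub]
  by_cases h : B = A
  · rw [h, hp.2.1, hq.2.1, sub_self]
  · rw [hp.2.2 B hB h, hq.2.2 B hB h, sub_self]

section Covers

open scoped Classical

/-- `S` consists of the four lines other than `e` whose product with `e` is the fundamental
polynomial of `P`. -/
structure IsCover (Y : Finset (ℝ × ℝ)) (e : Set (ℝ × ℝ)) (S : Finset (Set (ℝ × ℝ)))
    (P : ℝ × ℝ) : Prop where
  isLine : ∀ s ∈ S, IsLine s
  card : S.card = 4
  notMem_base : P ∉ e
  notMem : ∀ s ∈ S, P ∉ s
  cover : ∀ Q ∈ Y, Q ≠ P → Q ∉ e → ∃ s ∈ S, Q ∈ s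

lemma ncard_inter_eq_card_filter (Y : Finset (ℝ × ℝ)) (s : Set (ℝ × ℝ)) :
    ((Y : Set (ℝ × ℝ)) ∩ s).ncard = (Y.filter (· ∈ s)).card := by
  rw [← Set.ncard_coe_finset]
  congr 1
  ext
  simp

lemma card_filter_mem_le_of_GCSet {n : ℕ} {Y : Finset (ℝ × ℝ)} (hY : GCSet n (Y : Set (ℝ × ℝ)))
    {s : Set (ℝ × ℝ)} (hs : IsLine s) : (Y.filter (· ∈ s)).card ≤ n + 1 := by
  obtain h | ⟨P, hP⟩ := (Y.filter (· ∈ s)).eq_empty_or_nonempty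
  · simp [h]
  obtain ⟨hPY, hPs⟩ := Finset.mem_filter.1 hP
  obtain ⟨p, hp, f, hf, rfl⟩ := hY.2 P hPY
  have hPf : ∀ i, ev (f i) P ≠ 0 := fun i h0 => by
    have := hp.2.1
    rw [ev_prod, Finset.prod_eq_zero (Finset.mem_univ i) h0] at this
    exact zero_ne_one this
  have hsub : (Y.filter (· ∈ s)).erase P ⊆
      Finset.univ.biUnion fun i => (Y.filter (· ∈ s)).filter (· ∈ lineSet (f i)) := by
    intro Q hQ
    obtain ⟨hQP, hQ⟩ := Finset.mem_erase.1 hQ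
    have := hp.2.2 Q (Finset.mem_filter.1 hQ).1 hQP
    rw [ev_prod, Finset.prod_eq_zero_iff] at this
    obtain ⟨i, hi, hQi⟩ := this
    exact Finset.mem_biUnion.2 ⟨i, hi, Finset.mem_filter.2 ⟨hQ, hQi⟩⟩
  have hcard := (Finset.card_le_card hsub).trans
    (Finset.card_biUnion_le_card_mul _ _ 1 fun i _ => ?_)
  swap
  · refine Finset.card_le_one.2 fun Q hQ R hR => ?_
    simp only [Finset.mem_filter] at hQ hR
    refine hs.subsingleton_inter ⟨f i, hf i, rfl⟩ ?_ ⟨hQ.1.2, hQ.2⟩ ⟨hR.1.2, hR.2⟩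
    rintro rfl
    exact hPf i hPs
  rw [Finset.card_erase_of_mem hP, Finset.card_univ, Fintype.card_fin, mul_one] at hcard
  omega

lemma card_filter_mem_le {n : ℕ} {Y : Finset (ℝ × ℝ)} (hY : GCSet n (Y : Set (ℝ × ℝ)))
    (hnm : NoMaximalLine n (Y : Set (ℝ × ℝ))) {s : Set (ℝ × ℝ)} (hs : IsLine s) :
    (Y.filter (· ∈ s)).card ≤ n := by
  have h := card_filter_mem_le_of_GCSet hY hs
  obtain ⟨l, hl, rfl⟩ := hs
  have h' := hnm l hl
  rw [nodesOn, ncard_inter_eq_card_filter] at h'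
  omega

lemma card_eq_of_poised {n : ℕ} {Y : Finset (ℝ × ℝ)} (hY : Poised n (Y : Set (ℝ × ℝ))) :
    Y.card = (n + 2) * (n + 1) / 2 := by
  rw [← hY.2.1, Set.ncard_coe_finset]

variable {Y : Finset (ℝ × ℝ)} {e : Set (ℝ × ℝ)}

lemma card_filter_notMem (hY : Poised 5 (Y : Set (ℝ × ℝ)))
    (h3 : (Y.filter (· ∈ e)).card = 3) : (Y.filter (· ∉ e)).card = 18 := by
  have h := Y.card_filter_add_card_filter_not (· ∈ e)
  rw [card_eq_of_poised hY] at h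
  omega

/-- The nodes outside the line `e`, except `A` and `B`. -/
noncomputable def rest (Y : Finset (ℝ × ℝ)) (e : Set (ℝ × ℝ)) (A B : ℝ × ℝ) :
    Finset (ℝ × ℝ) := ((Y.filter (· ∉ e)).erase A).erase B

lemma mem_rest {A B Q : ℝ × ℝ} : Q ∈ rest Y e A B ↔ Q ≠ B ∧ Q ≠ A ∧ Q ∈ Y ∧ Q ∉ e := by
  simp [rest]

lemma card_rest (hY : Poised 5 (Y : Set (ℝ × ℝ))) (h3 : (Y.filter (· ∈ e)).card = 3)
    {A B : ℝ × ℝ} (hA : A ∈ Y) (hB : B ∈ Y) (hAB : A ≠ B) (hAe : A ∉ e) (hBe : B ∉ e) :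
    (rest Y e A B).card = 16 := by
  rw [rest, Finset.card_erase_of_mem, Finset.card_erase_of_mem, card_filter_notMem hY h3]
  · simp [hA, hAe]
  · simp [hB, hBe, hAB.symm]

lemma exists_isCover {l : MvPolynomial (Fin 2) ℝ} (hY : GCSet 5 (Y : Set (ℝ × ℝ)))
    (hnm : NoMaximalLine 5 (Y : Set (ℝ × ℝ))) (hl : IsLinePoly l)
    (h3 : (Y.filter (· ∈ lineSet l)).card = 3) {P : ℝ × ℝ} (hP : P ∈ Y)
    (hu : Uses 5 (Y : Set (ℝ × ℝ)) P l) : ∃ S, IsCover Y (lineSet l) S P := by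
  obtain ⟨p, hp, hlp⟩ := hu
  obtain ⟨q, hq, f, hf, rfl⟩ := hY.2 P hP
  obtain rfl := hp.unique hY.1 hq
  obtain ⟨i, -, hi⟩ := (hl.prime.dvd_finsetProd_iff f).1 hlp
  have hfi : lineSet (f i) = lineSet l := hl.lineSet_eq_of_dvd (hf i).ne_zero (hf i).le hi
  have hPf : ∀ j, P ∉ lineSet (f j) := fun j h0 => by
    have := hp.2.1
    rw [ev_prod, Finset.prod_eq_zero (Finset.mem_univ j) (mem_lineSet.1 h0)] at this
    exact zero_ne_one this
  let S := (Finset.univ.erase i).image fun j => lineSet (f j)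
  have hline : ∀ s ∈ S, IsLine s := fun s hs => by
    obtain ⟨j, -, rfl⟩ := Finset.mem_image.1 hs
    exact ⟨f j, hf j, rfl⟩
  have hcover : ∀ Q ∈ Y, Q ≠ P → Q ∉ lineSet l → ∃ s ∈ S, Q ∈ s := fun Q hQ hQP hQl => by
    have := hp.2.2 Q hQ hQP
    rw [ev_prod, Finset.prod_eq_zero_iff] at this
    obtain ⟨j, -, hj⟩ := this
    refine ⟨lineSet (f j), Finset.mem_image.2 ⟨j, ?_, rfl⟩, hj⟩
    rw [Finset.mem_erase]
    refine ⟨?_, Finset.mem_univ _⟩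
    rintro rfl
    exact hQl (hfi ▸ hj)
  have hle : S.card ≤ 4 := Finset.card_image_le.trans (by simp)
  have hsub : (Y.filter (· ∉ lineSet l)).erase P ⊆ S.biUnion fun s => Y.filter (· ∈ s) := by
    intro Q hQ
    simp only [Finset.mem_erase, Finset.mem_filter] at hQ
    obtain ⟨s, hs, hQs⟩ := hcover Q hQ.2.1 hQ.1 hQ.2.2
    exact Finset.mem_biUnion.2 ⟨s, hs, Finset.mem_filter.2 ⟨hQ.2.1, hQs⟩⟩
  have hge := (Finset.card_le_card hsub).trans
    (Finset.card_biUnion_le_card_mul S _ 5 fun s hs => card_filter_mem_le hY hnm (hline s hs))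
  have hPl : P ∉ lineSet l := hfi ▸ hPf i
  rw [Finset.card_erase_of_mem (by simp [hP, hPl]), card_filter_notMem hY.1 h3] at hge
  refine ⟨S, hline, by omega, hPl, fun s hs => ?_, hcover⟩
  obtain ⟨j, -, rfl⟩ := Finset.mem_image.1 hs
  exact hPf j

/-- Two coprime products of four lines vanishing on the same 16 nodes would give a syzygy
`q L + r M = 0` with linear `L`, `M`. -/
lemma IsCover.not_disjoint {S T : Finset (Set (ℝ × ℝ))} {A B : ℝ × ℝ}
    (hY : Poised 5 (Y : Set (ℝ × ℝ))) (h3 : (Y.filter (· ∈ e)).card = 3)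
    (hS : IsCover Y e S A) (hT : IsCover Y e T B) (hA : A ∈ Y) (hB : B ∈ Y) (hAB : A ≠ B) :
    ¬ Disjoint S T := by
  intro hdisj
  choose! f hf hfs using fun s (hs : IsLine s) => hs
  set q := ∏ s ∈ S, f s with hq
  set r := ∏ s ∈ T, f s with hr
  have hdeg : ∀ U : Finset (Set (ℝ × ℝ)), (∀ s ∈ U, IsLine s) → U.card = 4 →
      (∏ s ∈ U, f s).totalDegree ≤ 4 := fun U hU hc => by
    refine (totalDegree_finsetProd U f).trans ?_
    rw [Finset.sum_congr rfl fun s hs => hf s (hU s hs)]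
    simp [hc]
  have hne : ∀ U : Finset (Set (ℝ × ℝ)), (∀ s ∈ U, IsLine s) → ∏ s ∈ U, f s ≠ 0 :=
    fun U hU => Finset.prod_ne_zero_iff.2 fun s hs => (hf s (hU s hs)).ne_zero
  have hzero : ∀ U : Finset (Set (ℝ × ℝ)), (∀ s ∈ U, IsLine s) → ∀ Q, (∃ s ∈ U, Q ∈ s) →
      ev (∏ s ∈ U, f s) Q = 0 := fun U hU Q ⟨s, hs, hQ⟩ => by
    rw [ev_prod]
    refine Finset.prod_eq_zero hs ?_
    rwa [← mem_lineSet, hfs s (hU s hs)]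
  let comb (c : Fin 6 → ℝ) : MvPolynomial (Fin 2) ℝ :=
    q * linPoly (c 0) (c 1) (c 2) + r * linPoly (c 3) (c 4) (c 5)
  let Z := Y \ rest Y e A B
  have hZ : Z.card = 5 := by
    rw [Finset.card_sdiff_of_subset fun Q hQ => (mem_rest.1 hQ).2.2.1,
      card_rest hY h3 hA hB hAB hS.notMem_base hT.notMem_base, card_eq_of_poised hY]
  let φ : (Fin 6 → ℝ) →ₗ[ℝ] (Z → ℝ) :=
    { toFun := fun c Q => ev (comb c) Q
      map_add' := fun c d => by
        ext Q
        simp only [comb, ev_add, ev_mul, ev_linPoly, Pi.add_apply]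
        ring
      map_smul' := fun t c => by
        ext Q
        simp only [comb, ev_add, ev_mul, ev_linPoly, Pi.smul_apply, smul_eq_mul,
          RingHom.id_apply]
        ring }
  obtain ⟨c, hc, hc0⟩ := (Submodule.ne_bot_iff _).1
    (φ.ker_ne_bot_of_finrank_lt (by simp [hZ]))
  have hcomb : comb c = 0 := by
    refine hY.2.2 _ ?_ fun Q hQ => ?_
    · have hmul : ∀ (g : MvPolynomial (Fin 2) ℝ) (a b c : ℝ), g.totalDegree ≤ 4 →
          (g * linPoly a b c).totalDegree ≤ 5 := fun g a b c hg =>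
        (totalDegree_mul _ _).trans (add_le_add hg (totalDegree_linPoly_le a b c))
      exact (totalDegree_add _ _).trans (max_le (hmul _ _ _ _ (hdeg S hS.isLine hS.card))
        (hmul _ _ _ _ (hdeg T hT.isLine hT.card)))
    · by_cases hQr : Q ∈ rest Y e A B
      · obtain ⟨hQB, hQA, hQY, hQe⟩ := mem_rest.1 hQr
        simp only [comb, ev_add, ev_mul, hq, hr]
        rw [hzero S hS.isLine Q (hS.cover Q hQY hQA hQe),
          hzero T hT.isLine Q (hT.cover Q hQY hQB hQe)]
        ring
      · exact congr_fun (LinearMap.mem_ker.1 hc) ⟨Q, Finset.mem_sdiff.2 ⟨hQ, hQr⟩⟩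
  have hM : linPoly (c 3) (c 4) (c 5) = 0 := by
    by_contra hM0
    have hline : ∀ s ∈ S, lineSet (linPoly (c 3) (c 4) (c 5)) = s := fun s hs => by
      have hfl := hf s (hS.isLine s hs)
      have hdvd : f s ∣ r * linPoly (c 3) (c 4) (c 5) := by
        rw [← dvd_add_right ((Finset.dvd_prod_of_mem f hs).mul_right (linPoly (c 0) (c 1) (c 2)))]
        exact (dvd_zero _).trans hcomb.symm.dvd
      obtain h | h := hfl.prime.dvd_or_dvd hdvd
      · obtain ⟨t, ht, hst⟩ := (hfl.prime.dvd_finsetProd_iff f).1 h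
        have hft := hf t (hT.isLine t ht)
        have := hfl.lineSet_eq_of_dvd hft.ne_zero hft.le hst
        rw [hfs s (hS.isLine s hs), hfs t (hT.isLine t ht)] at this
        exact (Finset.disjoint_left.1 hdisj hs (this ▸ ht)).elim
      · rw [hfl.lineSet_eq_of_dvd hM0 (totalDegree_linPoly_le _ _ _) h, hfs s (hS.isLine s hs)]
    have : S.card ≤ 1 := Finset.card_le_one.2 fun s hs t ht => (hline s hs).symm.trans (hline t ht)
    rw [hS.card] at this
    omega
  have hL : linPoly (c 0) (c 1) (c 2) = 0 := by
    have : q * linPoly (c 0) (c 1) (c 2) = 0 := by simpa [comb, hM] using hcomb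
    exact (mul_eq_zero.1 this).resolve_left (hne S hS.isLine)
  apply hc0
  have h0 := coeff_linPoly_x (c 0) (c 1) (c 2)
  have h1 := coeff_linPoly_y (c 0) (c 1) (c 2)
  have h2 := coeff_linPoly_zero (c 0) (c 1) (c 2)
  have h3 := coeff_linPoly_x (c 3) (c 4) (c 5)
  have h4 := coeff_linPoly_y (c 3) (c 4) (c 5)
  have h5 := coeff_linPoly_zero (c 3) (c 4) (c 5)
  rw [hL, coeff_zero] at h0 h1 h2
  rw [hM, coeff_zero] at h3 h4 h5
  ext i
  fin_cases i <;> simp [← h0, ← h1, ← h2, ← h3, ← h4, ← h5]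

/-- `K` consists of three lines through five nodes each, disjoint on the nodes from each other and
from `e`, and `A`, `B`, `C` are the nodes lying on none of these lines. -/
structure IsTriple (Y : Finset (ℝ × ℝ)) (e : Set (ℝ × ℝ)) (K : Finset (Set (ℝ × ℝ)))
    (A B C : ℝ × ℝ) : Prop where
  isLine : ∀ m ∈ K, IsLine m
  card : K.card = 3
  five : ∀ m ∈ K, (Y.filter (· ∈ m)).card = 5
  notMem_base : ∀ m ∈ K, ∀ Q ∈ Y, Q ∈ m → Q ∉ e
  disjoint : ∀ m ∈ K, ∀ m' ∈ K, m ≠ m' → ∀ Q ∈ Y, Q ∈ m → Q ∉ m'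
  mem_iff : ∀ Q, (Q ∈ Y ∧ Q ∉ e ∧ ∀ m ∈ K, Q ∉ m) ↔ Q = A ∨ Q = B ∨ Q = C
  ne_AB : A ≠ B
  ne_AC : A ≠ C
  ne_BC : B ≠ C

lemma IsTriple.swap {K : Finset (Set (ℝ × ℝ))} {A B C : ℝ × ℝ} (h : IsTriple Y e K A B C) :
    IsTriple Y e K B A C :=
  { h with
    mem_iff := fun Q => (h.mem_iff Q).trans or_left_comm
    ne_AB := h.ne_AB.symm
    ne_AC := h.ne_BC
    ne_BC := h.ne_AC }

lemma IsTriple.rotate {K : Finset (Set (ℝ × ℝ))} {A B C : ℝ × ℝ} (h : IsTriple Y e K A B C) :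
    IsTriple Y e K C A B :=
  { h with
    mem_iff := fun Q => (h.mem_iff Q).trans (by tauto)
    ne_AB := h.ne_AC.symm
    ne_AC := h.ne_BC.symm
    ne_BC := h.ne_AB }

lemma IsCover.exists_isTriple {S T : Finset (Set (ℝ × ℝ))} {A B : ℝ × ℝ}
    (hY : GCSet 5 (Y : Set (ℝ × ℝ))) (hnm : NoMaximalLine 5 (Y : Set (ℝ × ℝ)))
    (h3 : (Y.filter (· ∈ e)).card = 3)
    (hS : IsCover Y e S A) (hT : IsCover Y e T B) (hA : A ∈ Y) (hB : B ∈ Y) (hAB : A ≠ B) :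
    ∃ C, IsTriple Y e (S ∩ T) A B C := by
  set K := S ∩ T
  have hKline : ∀ m ∈ K, IsLine m := fun m hm => hS.isLine m (Finset.mem_inter.1 hm).1
  set M := rest Y e A B
  have hMcard : M.card = 16 := card_rest hY.1 h3 hA hB hAB hS.notMem_base hT.notMem_base
  have hMY : ∀ m : Set (ℝ × ℝ), M.filter (· ∈ m) ⊆ Y.filter (· ∈ m) := fun m =>
    Finset.filter_subset_filter _ fun Q hQ => (mem_rest.1 hQ).2.2.1
  have hfive : ∀ m ∈ K, (M.filter (· ∈ m)).card ≤ 5 := fun m hm =>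
    (Finset.card_le_card (hMY m)).trans (card_filter_mem_le hY hnm (hKline m hm))
  set U := K.biUnion fun m => M.filter (· ∈ m)
  have hUM : U ⊆ M := Finset.biUnion_subset.2 fun m _ => Finset.filter_subset _ _
  have hUcard : U.card ≤ K.card * 5 := Finset.card_biUnion_le_card_mul _ _ _ hfive
  have hcross : M \ U ⊆ ((S \ K) ×ˢ (T \ K)).biUnion fun st =>
      M.filter (· ∈ st.1 ∩ st.2) := by
    intro Q hQ
    obtain ⟨hQM, hQU⟩ := Finset.mem_sdiff.1 hQ
    obtain ⟨hQB, hQA, hQY, hQe⟩ := mem_rest.1 hQM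
    have hQK : ∀ m ∈ K, Q ∉ m := fun m hm hQm =>
      hQU (Finset.mem_biUnion.2 ⟨m, hm, Finset.mem_filter.2 ⟨hQM, hQm⟩⟩)
    obtain ⟨s, hs, hQs⟩ := hS.cover Q hQY hQA hQe
    obtain ⟨t, ht, hQt⟩ := hT.cover Q hQY hQB hQe
    refine Finset.mem_biUnion.2 ⟨(s, t), Finset.mem_product.2 ⟨?_, ?_⟩,
      Finset.mem_filter.2 ⟨hQM, hQs, hQt⟩⟩
    · exact Finset.mem_sdiff.2 ⟨hs, fun h => hQK s h hQs⟩
    · exact Finset.mem_sdiff.2 ⟨ht, fun h => hQK t h hQt⟩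
  have hrest := (Finset.card_le_card hcross).trans
    (Finset.card_biUnion_le_card_mul _ _ 1 fun st hst => ?_)
  swap
  · simp only [Finset.mem_product, Finset.mem_sdiff] at hst
    refine Finset.card_le_one.2 fun Q hQ R hR => ?_
    refine (hS.isLine _ hst.1.1).subsingleton_inter (hT.isLine _ hst.2.1) (fun h => ?_)
      (Finset.mem_filter.1 hQ).2 (Finset.mem_filter.1 hR).2
    exact hst.1.2 (Finset.mem_inter.2 ⟨hst.1.1, h ▸ hst.2.1⟩)
  rw [Finset.card_sdiff_of_subset hUM, Finset.card_product,
    Finset.card_sdiff_of_subset Finset.inter_subset_left,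
    Finset.card_sdiff_of_subset Finset.inter_subset_right, hS.card, hT.card, hMcard, mul_one]
    at hrest
  have hK0 : K.card ≠ 0 := fun h =>
    hS.not_disjoint hY.1 h3 hT hA hB hAB
      (Finset.disjoint_iff_inter_eq_empty.2 (Finset.card_eq_zero.1 h))
  have hK4 : K.card ≠ 4 := fun h => by
    have hST : K = S := Finset.eq_of_subset_of_card_le Finset.inter_subset_left (by rw [h, hS.card])
    obtain ⟨s, hs, hBs⟩ := hS.cover B hB hAB.symm hT.notMem_base
    exact hT.notMem s (Finset.mem_inter.1 (hST ▸ hs : s ∈ K)).2 hBs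
  have hKle : K.card ≤ 4 := hS.card ▸ Finset.card_le_card Finset.inter_subset_left
  have hK3 : K.card = 3 := by
    interval_cases K.card <;> omega
  rw [hK3] at hrest hUcard
  have hU15 : U.card = 15 := by omega
  have hsdiff : ∀ m ∈ K, ∀ V : Finset (ℝ × ℝ),
      U ⊆ (K.erase m).biUnion (fun m' => M.filter (· ∈ m')) ∪ V → 5 ≤ V.card := by
    intro m hm V hV
    have h1 := (Finset.card_le_card hV).trans (Finset.card_union_le _ _)
    have h2 := Finset.card_biUnion_le_card_mul (K.erase m) (fun m' => M.filter (· ∈ m')) 5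
      fun m' hm' => hfive m' (Finset.mem_of_mem_erase hm')
    rw [Finset.card_erase_of_mem hm, hK3] at h2
    omega
  have hM5 : ∀ m ∈ K, 5 ≤ (M.filter (· ∈ m)).card := fun m hm => by
    refine hsdiff m hm _ fun Q hQ => ?_
    obtain ⟨m', hm', hQm⟩ := Finset.mem_biUnion.1 hQ
    by_cases h : m' = m
    · exact Finset.mem_union_right _ (h ▸ hQm)
    · exact Finset.mem_union_left _
        (Finset.mem_biUnion.2 ⟨m', Finset.mem_erase.2 ⟨h, hm'⟩, hQm⟩)
  have hMeq : ∀ m ∈ K, M.filter (· ∈ m) = Y.filter (· ∈ m) := fun m hm =>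
    Finset.eq_of_subset_of_card_le (hMY m)
      ((card_filter_mem_le hY hnm (hKline m hm)).trans (hM5 m hm))
  have hmemM : ∀ m ∈ K, ∀ Q ∈ Y, Q ∈ m → Q ∈ M := fun m hm Q hQ hQm => by
    have : Q ∈ M.filter (· ∈ m) := by rw [hMeq m hm]; exact Finset.mem_filter.2 ⟨hQ, hQm⟩
    exact (Finset.mem_filter.1 this).1
  obtain ⟨C, hC⟩ : ∃ C, M \ U = {C} := by
    rw [← Finset.card_eq_one, Finset.card_sdiff_of_subset hUM, hMcard, hU15]
  have hCM : C ∈ M \ U := hC ▸ Finset.mem_singleton_self C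
  obtain ⟨hCM, hCU⟩ := Finset.mem_sdiff.1 hCM
  obtain ⟨hCB, hCA, hCY, hCe⟩ := mem_rest.1 hCM
  refine ⟨C, hKline, hK3, fun m hm => ?_, fun m hm Q hQ hQm => ?_, ?_, fun Q => ⟨?_, ?_⟩,
    hAB, hCA.symm, hCB.symm⟩
  · rw [← hMeq m hm]
    exact le_antisymm (hfive m hm) (hM5 m hm)
  · exact (mem_rest.1 (hmemM m hm Q hQ hQm)).2.2.2
  · intro m hm m' hm' hne Q hQ hQm hQm'
    have h5 := hsdiff m hm (M.filter (· ∈ m) \ M.filter (· ∈ m')) fun R hR => by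
      obtain ⟨m'', hm'', hRm⟩ := Finset.mem_biUnion.1 hR
      by_cases h : m'' = m
      · subst h
        by_cases hRm' : R ∈ M.filter (· ∈ m')
        · exact Finset.mem_union_left _
            (Finset.mem_biUnion.2 ⟨m', Finset.mem_erase.2 ⟨hne.symm, hm'⟩, hRm'⟩)
        · exact Finset.mem_union_right _ (Finset.mem_sdiff.2 ⟨hRm, hRm'⟩)
      · exact Finset.mem_union_left _
          (Finset.mem_biUnion.2 ⟨m'', Finset.mem_erase.2 ⟨h, hm''⟩, hRm⟩)
    have hQM := hmemM m hm Q hQ hQm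
    have hlt : (M.filter (· ∈ m) \ M.filter (· ∈ m')).card < (M.filter (· ∈ m)).card := by
      refine Finset.card_lt_card (Finset.ssubset_iff_of_subset Finset.sdiff_subset |>.2 ⟨Q, ?_, ?_⟩)
      · exact Finset.mem_filter.2 ⟨hQM, hQm⟩
      · exact fun h => (Finset.mem_sdiff.1 h).2 (Finset.mem_filter.2 ⟨hQM, hQm'⟩)
    have := hfive m hm
    omega
  · rintro ⟨hQY, hQe, hQK⟩
    by_cases hQA : Q = A
    · exact Or.inl hQA
    by_cases hQB : Q = B
    · exact Or.inr (Or.inl hQB)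
    have : Q ∈ M \ U := by
      refine Finset.mem_sdiff.2 ⟨mem_rest.2 ⟨hQB, hQA, hQY, hQe⟩, fun hQU => ?_⟩
      obtain ⟨m, hm, hQm⟩ := Finset.mem_biUnion.1 hQU
      exact hQK m hm (Finset.mem_filter.1 hQm).2
    rw [hC] at this
    exact Or.inr (Or.inr (Finset.mem_singleton.1 this))
  · rintro (rfl | rfl | rfl)
    · exact ⟨hA, hS.notMem_base, fun m hm => hS.notMem m (Finset.mem_inter.1 hm).1⟩
    · exact ⟨hB, hT.notMem_base, fun m hm => hT.notMem m (Finset.mem_inter.1 hm).2⟩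
    · exact ⟨hCY, hCe, fun m hm h =>
        hCU (Finset.mem_biUnion.2 ⟨m, hm, Finset.mem_filter.2 ⟨hCM, h⟩⟩)⟩

/-- The fourth line of a cover of `A` containing the triple passes through `B` and `C`. -/
lemma IsTriple.exists_fourth {S K : Finset (Set (ℝ × ℝ))} {A B C : ℝ × ℝ}
    (h : IsTriple Y e K A B C) (hS : IsCover Y e S A) (hKS : K ⊆ S) :
    ∃ a, S = insert a K ∧ IsLine a ∧ A ∉ a ∧ B ∈ a ∧ C ∈ a := by
  obtain ⟨a, ha⟩ : ∃ a, S \ K = {a} := by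
    rw [← Finset.card_eq_one, Finset.card_sdiff_of_subset hKS, hS.card, h.card]
  have haS : a ∈ S := (Finset.mem_sdiff.1 (ha ▸ Finset.mem_singleton_self a : a ∈ S \ K)).1
  have hmem : ∀ Q, Q = B ∨ Q = C → Q ≠ A → Q ∈ a := fun Q hQ hQA => by
    obtain ⟨hQY, hQe, hQK⟩ := (h.mem_iff Q).2 (Or.inr hQ)
    obtain ⟨s, hs, hQs⟩ := hS.cover Q hQY hQA hQe
    have : s ∈ S \ K := Finset.mem_sdiff.2 ⟨hs, fun hsK => hQK s hsK hQs⟩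
    rw [ha, Finset.mem_singleton] at this
    exact this ▸ hQs
  refine ⟨a, ?_, hS.isLine a haS, hS.notMem a haS, hmem B (Or.inl rfl) h.ne_AB.symm,
    hmem C (Or.inr rfl) h.ne_AC.symm⟩
  rw [Finset.insert_eq, ← ha, Finset.sdiff_union_of_subset hKS]

/-- No node outside the triple admits a cover. -/
lemma IsTriple.eq_of_isCover {S T : Finset (Set (ℝ × ℝ))} {A B C D : ℝ × ℝ}
    (hY : GCSet 5 (Y : Set (ℝ × ℝ))) (hnm : NoMaximalLine 5 (Y : Set (ℝ × ℝ)))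
    (h3 : (Y.filter (· ∈ e)).card = 3) (h : IsTriple Y e (S ∩ T) A B C)
    (hS : IsCover Y e S A) {W : Finset (Set (ℝ × ℝ))} (hW : IsCover Y e W D) (hD : D ∈ Y) :
    D = A ∨ D = B ∨ D = C := by
  by_contra hne
  have hAD : A ≠ D := fun hAD => hne (Or.inl hAD.symm)
  obtain ⟨E, hE⟩ := hS.exists_isTriple hY hnm h3 hW ((h.mem_iff A).2 (Or.inl rfl)).1 hD hAD
  obtain ⟨a, hSa, ha, hAa, -, -⟩ := h.exists_fourth hS Finset.inter_subset_left
  obtain ⟨m, hm, hDm⟩ : ∃ m ∈ S ∩ T, D ∈ m := by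
    by_contra! hD'
    exact hne ((h.mem_iff D).1 ⟨hD, hW.notMem_base, hD'⟩)
  have hmS := (Finset.mem_inter.1 hm).1
  have hmW : m ∉ S ∩ W := fun hmW => hW.notMem m (Finset.mem_inter.1 hmW).2 hDm
  have hSW : S ∩ W = S.erase m := by
    refine Finset.eq_of_subset_of_card_le (fun s hs => Finset.mem_erase.2 ⟨?_, ?_⟩) ?_
    · rintro rfl
      exact hmW hs
    · exact (Finset.mem_inter.1 hs).1
    · rw [Finset.card_erase_of_mem hmS, hS.card, hE.card]
  have haK : a ∉ S ∩ T := fun haK => by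
    have := hS.card
    rw [hSa, Finset.insert_eq_of_mem haK, h.card] at this
    omega
  have ham : a ≠ m := fun ham => haK (ham ▸ hm)
  have haS : a ∈ S := hSa ▸ Finset.mem_insert_self _ _
  have haSW : a ∈ S ∩ W := hSW ▸ Finset.mem_erase.2 ⟨ham, haS⟩
  have hsub : Y.filter (· ∈ a) ⊆ {B, C} ∪ Y.filter (· ∈ a ∩ m) := by
    intro Q hQ
    obtain ⟨hQY, hQa⟩ := Finset.mem_filter.1 hQ
    have hQe := hE.notMem_base a haSW Q hQY hQa
    by_cases hQm : Q ∈ m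
    · exact Finset.mem_union_right _ (Finset.mem_filter.2 ⟨hQY, hQa, hQm⟩)
    refine Finset.mem_union_left _ ?_
    have hQK : ∀ s ∈ S ∩ T, Q ∉ s := fun s hs hQs => by
      have hsS := (Finset.mem_inter.1 hs).1
      have hsm : s ≠ m := fun h' => hQm (h' ▸ hQs)
      have has : a ≠ s := fun h' => haK (h' ▸ hs)
      exact hE.disjoint a haSW s (hSW ▸ Finset.mem_erase.2 ⟨hsm, hsS⟩) has Q hQY hQa hQs
    obtain rfl | h' | h' := (h.mem_iff Q).1 ⟨hQY, hQe, hQK⟩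
    · exact absurd hQa hAa
    · simp [h']
    · simp [h']
  have h1 : (Y.filter (· ∈ a ∩ m)).card ≤ 1 := Finset.card_le_one.2 fun Q hQ R hR =>
    ha.subsingleton_inter (hS.isLine m hmS) ham (Finset.mem_filter.1 hQ).2
      (Finset.mem_filter.1 hR).2
  have h2 := (Finset.card_le_card hsub).trans (Finset.card_union_le _ _)
  rw [hE.five a haSW] at h2
  have h4 : ({B, C} : Finset (ℝ × ℝ)).card ≤ 2 := Finset.card_le_two
  omega

variable {m1 m2 m3 l a : MvPolynomial (Fin 2) ℝ} {A B C : ℝ × ℝ}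

lemma IsTriple.ev_ne_zero
    (h : IsTriple Y (lineSet l) {lineSet m1, lineSet m2, lineSet m3} A B C) {Q : ℝ × ℝ}
    (hQ : Q = A ∨ Q = B ∨ Q = C) :
    ev m1 Q ≠ 0 ∧ ev m2 Q ≠ 0 ∧ ev m3 Q ≠ 0 ∧ ev l Q ≠ 0 := by
  obtain ⟨-, hl, hK⟩ := (h.mem_iff Q).2 hQ
  simp only [Finset.mem_insert, Finset.mem_singleton, forall_eq_or_imp, forall_eq] at hK
  exact ⟨hK.1, hK.2.1, hK.2.2, hl⟩

lemma IsTriple.exists_isFund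
    (h : IsTriple Y (lineSet l) {lineSet m1, lineSet m2, lineSet m3} A B C)
    (h1 : IsLinePoly m1) (h2 : IsLinePoly m2) (h3 : IsLinePoly m3) (hl : IsLinePoly l)
    (ha : IsLinePoly a) (haA : A ∉ lineSet a) (haB : B ∈ lineSet a) (haC : C ∈ lineSet a) :
    ∃ c : ℝ, IsFund 5 (Y : Set (ℝ × ℝ)) A
      (MvPolynomial.C c * ∏ i, ![m1, m2, m3, l, a] i) := by
  obtain ⟨e1, e2, e3, el⟩ := h.ev_ne_zero (Or.inl rfl)
  have hev : ∀ Q, ev (∏ i, ![m1, m2, m3, l, a] i) Q =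
      ev m1 Q * ev m2 Q * ev m3 Q * ev l Q * ev a Q := fun Q => by
    rw [ev_prod, Fin.prod_univ_five]
    rfl
  have hA : ev (∏ i, ![m1, m2, m3, l, a] i) A ≠ 0 := by
    rw [hev]
    exact mul_ne_zero (mul_ne_zero (mul_ne_zero (mul_ne_zero e1 e2) e3) el) haA
  refine ⟨(ev (∏ i, ![m1, m2, m3, l, a] i) A)⁻¹, ?_, ?_, fun Q hQ hQA => ?_⟩
  · refine (totalDegree_mul _ _).trans ?_
    rw [totalDegree_C, zero_add]
    refine (totalDegree_finsetProd _ _).trans ?_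
    rw [Finset.sum_congr rfl fun i _ => show (![m1, m2, m3, l, a] i).totalDegree = 1 by
      fin_cases i <;> assumption]
    simp
  · rw [ev_mul, ev_C, inv_mul_cancel₀ hA]
  · rw [ev_mul, hev Q]
    by_cases hB : Q = B ∨ Q = C
    · have : ev a Q = 0 := by obtain rfl | rfl := hB <;> assumption
      simp [this]
    · have hn := mt (h.mem_iff Q).1 (not_or.2 ⟨hQA, hB⟩)
      simp only [Finset.mem_insert, Finset.mem_singleton, forall_eq_or_imp, forall_eq,
        mem_lineSet] at hn
      by_contra! h0
      simp only [mul_ne_zero_iff] at h0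
      exact hn ⟨hQ, h0.2.1.2, h0.2.1.1.1.1, h0.2.1.1.1.2, h0.2.1.1.2⟩

lemma resCount_le_card (L : Fin 5 → MvPolynomial (Fin 2) ℝ) (s : Fin 5)
    (p : MvPolynomial (Fin 2) ℝ) :
    resCount (Y : Set (ℝ × ℝ)) L s p ≤ (Y.filter (· ∈ lineSet p)).card := by
  rw [← ncard_inter_eq_card_filter]
  exact Set.ncard_le_ncard (fun Q hQ => ⟨hQ.1, hQ.2.1⟩) (Y.finite_toSet.inter_of_left _)

lemma resCount_eq_card {L : Fin 5 → MvPolynomial (Fin 2) ℝ} {s : Fin 5}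
    {p : MvPolynomial (Fin 2) ℝ}
    (h : ∀ i < s, ∀ Q ∈ Y, Q ∈ lineSet p → Q ∉ lineSet (L i)) :
    resCount (Y : Set (ℝ × ℝ)) L s p = (Y.filter (· ∈ lineSet p)).card := by
  rw [← ncard_inter_eq_card_filter, resCount]
  congr 1
  ext Q
  exact ⟨fun hQ => ⟨hQ.1, hQ.2.1⟩, fun hQ => ⟨hQ.1, hQ.2, fun i hi => h i hi Q hQ.1 hQ.2⟩⟩

lemma IsTriple.hasMDSeq (hY : GCSet 5 (Y : Set (ℝ × ℝ)))
    (hnm : NoMaximalLine 5 (Y : Set (ℝ × ℝ)))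
    (h : IsTriple Y (lineSet l) {lineSet m1, lineSet m2, lineSet m3} A B C)
    (hl3 : (Y.filter (· ∈ lineSet l)).card = 3)
    (h1 : IsLinePoly m1) (h2 : IsLinePoly m2) (h3 : IsLinePoly m3) (hl : IsLinePoly l)
    (ha : IsLinePoly a) (haA : A ∉ lineSet a) (haB : B ∈ lineSet a) (haC : C ∈ lineSet a)
    (h12 : lineSet m1 ≠ lineSet m2) (h13 : lineSet m1 ≠ lineSet m3)
    (h23 : lineSet m2 ≠ lineSet m3) :
    HasMDSeq (Y : Set (ℝ × ℝ)) A ![5, 5, 5, 3, 2] := by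
  obtain ⟨c, hc⟩ := h.exists_isFund h1 h2 h3 hl ha haA haB haC
  obtain ⟨b1, b2, b3, bl⟩ := h.ev_ne_zero (Or.inr (Or.inl rfl))
  have hne : ∀ p : MvPolynomial (Fin 2) ℝ, ev p B ≠ 0 → lineSet p ≠ lineSet a :=
    fun p hp hpa => hp (hpa ▸ haB : B ∈ lineSet p)
  have hfive := h.five
  have hbase := h.notMem_base
  have hdisj := h.disjoint
  simp only [Finset.mem_insert, Finset.mem_singleton, forall_eq_or_imp, forall_eq] at hfive hbase
  obtain ⟨f1, f2, f3⟩ := hfive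
  obtain ⟨k1, k2, k3⟩ := hbase
  have d12 := hdisj _ (by simp) (lineSet m2) (by simp) h12
  have d13 := hdisj _ (by simp) (lineSet m3) (by simp) h13
  have d23 := hdisj _ (by simp) (lineSet m3) (by simp) h23
  have hnel : ∀ p : MvPolynomial (Fin 2) ℝ, (Y.filter (· ∈ lineSet p)).card = 5 →
      lineSet p ≠ lineSet l := fun p hp hpl => by
    rw [hpl, hl3] at hp
    omega
  set L := ![m1, m2, m3, l, a] with hL
  have hline : ∀ i, IsLinePoly (L i) := fun i => by fin_cases i <;> assumption
  have r0 : resCount (Y : Set (ℝ × ℝ)) L 0 m1 = 5 :=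
    (resCount_eq_card fun i hi => absurd hi (Fin.not_lt_zero i)).trans f1
  have r1 : resCount (Y : Set (ℝ × ℝ)) L 1 m2 = 5 := by
    refine (resCount_eq_card fun i hi Q hQ hQm hQi => ?_).trans f2
    obtain rfl : i = 0 := by omega
    exact d12 Q hQ hQi hQm
  have r2 : resCount (Y : Set (ℝ × ℝ)) L 2 m3 = 5 := by
    refine (resCount_eq_card fun i hi Q hQ hQm hQi => ?_).trans f3
    obtain rfl | rfl : i = 0 ∨ i = 1 := by omega
    · exact d13 Q hQ hQi hQm
    · exact d23 Q hQ hQi hQm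
  have r3 : resCount (Y : Set (ℝ × ℝ)) L 3 l = 3 := by
    refine (resCount_eq_card fun i hi Q hQ hQm hQi => ?_).trans hl3
    obtain rfl | rfl | rfl : i = 0 ∨ i = 1 ∨ i = 2 := by omega
    · exact k1 Q hQ hQi hQm
    · exact k2 Q hQ hQi hQm
    · exact k3 Q hQ hQi hQm
  have hmem : ∀ Q, (Q ∈ Y ∧ ev l Q ≠ 0 ∧ ev m1 Q ≠ 0 ∧ ev m2 Q ≠ 0 ∧ ev m3 Q ≠ 0) ↔
      Q = A ∨ Q = B ∨ Q = C := fun Q => by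
    rw [← h.mem_iff]
    simp [mem_lineSet]
  have r4 : resCount (Y : Set (ℝ × ℝ)) L 4 a = 2 := by
    rw [resCount, ← Set.ncard_pair h.ne_BC]
    congr 1
    ext Q
    simp only [Set.mem_insert_iff, Set.mem_singleton_iff]
    constructor
    · rintro ⟨hQ, hQa, hQL⟩
      have := (hmem Q).1 ⟨hQ, hQL 3 (by decide), hQL 0 (by decide), hQL 1 (by decide),
        hQL 2 (by decide)⟩
      refine this.resolve_left ?_
      rintro rfl
      exact haA hQa
    · intro hQ
      obtain ⟨hQY, q4, q1, q2, q3⟩ := (hmem Q).2 (Or.inr hQ)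
      refine ⟨hQY, by obtain rfl | rfl := hQ <;> assumption, fun i hi => ?_⟩
      obtain rfl | rfl | rfl | rfl : i = 0 ∨ i = 1 ∨ i = 2 ∨ i = 3 := by omega
      · exact q1
      · exact q2
      · exact q3
      · exact q4
  have r34 : resCount (Y : Set (ℝ × ℝ)) L 3 a ≤ 3 := by
    have hsub : {Q ∈ (Y : Set (ℝ × ℝ)) | ev a Q = 0 ∧ ∀ i : Fin 5, i < 3 → ev (L i) Q ≠ 0} ⊆
        {B, C} ∪ (lineSet l ∩ lineSet a) := by
      rintro Q ⟨hQ, hQa, hQL⟩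
      by_cases hQl : ev l Q = 0
      · exact Or.inr ⟨hQl, hQa⟩
      left
      refine ((hmem Q).1 ⟨hQ, hQl, hQL 0 (by decide), hQL 1 (by decide),
        hQL 2 (by decide)⟩).resolve_left ?_
      rintro rfl
      exact haA hQa
    have hs := IsLine.subsingleton_inter ⟨l, hl, rfl⟩ ⟨a, ha, rfl⟩ (hne l bl)
    refine (Set.ncard_le_ncard hsub ((Set.toFinite _).union hs.finite)).trans
      ((Set.ncard_union_le _ _).trans ?_)
    rw [Set.ncard_pair h.ne_BC]
    have := hs.finite.to_subtype
    have := Set.ncard_le_one_iff_subsingleton.2 hs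
    omega
  have hle : ∀ s t : Fin 5, resCount (Y : Set (ℝ × ℝ)) L s (L t) ≤ 5 := fun s t =>
    (resCount_le_card L s (L t)).trans (card_filter_mem_le hY hnm ⟨L t, hline t, rfl⟩)
  refine ⟨L, ⟨hline, ?_, ⟨_, hc, c, rfl⟩, fun s t hst => ?_⟩, fun s => ?_⟩
  · have hlt : ∀ i j : Fin 5, i < j → lineSet (L i) ≠ lineSet (L j) := fun i j hij => by
      obtain ⟨rfl | rfl | rfl | rfl, rfl⟩ | ⟨rfl | rfl | rfl, rfl⟩ | ⟨rfl | rfl, rfl⟩ |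
          ⟨rfl, rfl⟩ :
          ((i = 0 ∨ i = 1 ∨ i = 2 ∨ i = 3) ∧ j = 4) ∨ ((i = 0 ∨ i = 1 ∨ i = 2) ∧ j = 3) ∨
          ((i = 0 ∨ i = 1) ∧ j = 2) ∨ (i = 0 ∧ j = 1) := by omega
      exacts [hne _ b1, hne _ b2, hne _ b3, hne _ bl, hnel _ f1, hnel _ f2, hnel _ f3,
        h13, h23, h12]
    intro i j hij
    obtain hij | hij := lt_or_gt_of_ne hij
    · exact hlt i j hij
    · exact (hlt j i hij).symm
  · fin_cases s
    · exact (hle 0 t).trans r0.ge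
    · exact (hle 1 t).trans r1.ge
    · exact (hle 2 t).trans r2.ge
    · obtain rfl | rfl : t = 3 ∨ t = 4 := by
        change 3 ≤ t at hst
        omega
      · exact le_rfl
      · exact r34.trans r3.ge
    · obtain rfl : t = 4 := by
        change 4 ≤ t at hst
        omega
      exact le_rfl
  · fin_cases s
    exacts [r0, r1, r2, r3, r4]

lemma IsTriple.uses
    (h : IsTriple Y (lineSet l) {lineSet m1, lineSet m2, lineSet m3} A B C)
    (h1 : IsLinePoly m1) (h2 : IsLinePoly m2) (h3 : IsLinePoly m3) (hl : IsLinePoly l)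
    (ha : IsLinePoly a) (haA : A ∉ lineSet a) (haB : B ∈ lineSet a) (haC : C ∈ lineSet a)
    (i : Fin 5) : Uses 5 (Y : Set (ℝ × ℝ)) A (![m1, m2, m3, l, a] i) := by
  obtain ⟨c, hc⟩ := h.exists_isFund h1 h2 h3 hl ha haA haB haC
  exact ⟨_, hc, (Finset.dvd_prod_of_mem _ (Finset.mem_univ i)).mul_left _⟩

end Covers

/-- in a `GC_5` set with no maximal line, if a 3-node line `l` is used by two
distinct nodes `A, B`, then a third node `C` uses `l`; `A, B, C` share three further common
used lines, each passing through five primary nodes; each of `A, B, C` has m-d sequence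
`(5,5,5,3,2)`; and `l` is used by exactly the three nodes `A, B, C`. -/
theorem three_node_line_used_three_times (X : Set (ℝ × ℝ)) (hX : GCSet 5 X)
    (hnm : NoMaximalLine 5 X) (l : MvPolynomial (Fin 2) ℝ) (hl : IsLinePoly l)
    (h3 : nodesOn X l = 3) (A B : ℝ × ℝ) (hA : A ∈ X) (hB : B ∈ X) (hAB : A ≠ B)
    (hAu : Uses 5 X A l) (hBu : Uses 5 X B l) :
    ∃ C ∈ X, C ≠ A ∧ C ≠ B ∧ Uses 5 X C l ∧
      (∃ m1 m2 m3 : MvPolynomial (Fin 2) ℝ,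
        IsLinePoly m1 ∧ IsLinePoly m2 ∧ IsLinePoly m3 ∧
        lineSet m1 ≠ lineSet m2 ∧ lineSet m1 ≠ lineSet m3 ∧ lineSet m2 ≠ lineSet m3 ∧
        lineSet m1 ≠ lineSet l ∧ lineSet m2 ≠ lineSet l ∧ lineSet m3 ≠ lineSet l ∧
        (∀ P ∈ ({A, B, C} : Set (ℝ × ℝ)),
          Uses 5 X P m1 ∧ Uses 5 X P m2 ∧ Uses 5 X P m3) ∧
        nodesOn X m1 = 5 ∧ nodesOn X m2 = 5 ∧ nodesOn X m3 = 5 ∧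
        Disjoint (X ∩ lineSet m1) (X ∩ lineSet m2) ∧
        Disjoint (X ∩ lineSet m1) (X ∩ lineSet m3) ∧
        Disjoint (X ∩ lineSet m2) (X ∩ lineSet m3)) ∧
      HasMDSeq X A ![5, 5, 5, 3, 2] ∧ HasMDSeq X B ![5, 5, 5, 3, 2] ∧
      HasMDSeq X C ![5, 5, 5, 3, 2] ∧
      {D | D ∈ X ∧ Uses 5 X D l} = {A, B, C} := by
  classical
  lift X to Finset (ℝ × ℝ) using hX.1.1 with Y
  have hl3 : (Y.filter (· ∈ lineSet l)).card = 3 := by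
    rw [← ncard_inter_eq_card_filter]
    exact h3
  obtain ⟨S, hS⟩ := exists_isCover hX hnm hl hl3 hA hAu
  obtain ⟨T, hT⟩ := exists_isCover hX hnm hl hl3 hB hBu
  obtain ⟨C, hC⟩ := hS.exists_isTriple hX hnm hl3 hT hA hB hAB
  obtain ⟨-, -, ⟨a, ha, rfl⟩, haA, haB, haC⟩ := hC.exists_fourth hS Finset.inter_subset_left
  obtain ⟨-, -, ⟨b, hb, rfl⟩, hbB, hbA, hbC⟩ :=
    hC.swap.exists_fourth hT Finset.inter_subset_right
  obtain ⟨c, hc, hcA, hcB⟩ := exists_linePoly_through hAB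
  have hcC : C ∉ lineSet c := fun hcC => by
    have := IsLine.eq_of_mem ⟨a, ha, rfl⟩ ⟨c, hc, rfl⟩ hC.ne_BC haB haC hcB hcC
    exact haA (this ▸ hcA)
  have hCY := ((hC.mem_iff C).2 (Or.inr (Or.inr rfl))).1
  have huniq : ∀ D ∈ Y, Uses 5 (Y : Set (ℝ × ℝ)) D l → D = A ∨ D = B ∨ D = C :=
    fun D hD hDu => by
      obtain ⟨W, hW⟩ := exists_isCover hX hnm hl hl3 hD hDu
      exact hC.eq_of_isCover hX hnm hl3 hS hW hD
  obtain ⟨s1, s2, s3, h12, h13, h23, hK⟩ := Finset.card_eq_three.1 hC.card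
  rw [hK] at hC
  obtain ⟨m1, h1, rfl⟩ := hC.isLine s1 (by simp)
  obtain ⟨m2, h2, rfl⟩ := hC.isLine s2 (by simp)
  obtain ⟨m3, h3, rfl⟩ := hC.isLine s3 (by simp)
  have uA := hC.uses h1 h2 h3 hl ha haA haB haC
  have uB := hC.swap.uses h1 h2 h3 hl hb hbB hbA hbC
  have uC := hC.rotate.uses h1 h2 h3 hl hc hcC hcA hcB
  have hfive : ∀ m, lineSet m ∈ ({lineSet m1, lineSet m2, lineSet m3} : Finset _) →
      nodesOn (Y : Set (ℝ × ℝ)) m = 5 := fun m hm => by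
    rw [nodesOn, ncard_inter_eq_card_filter, hC.five _ hm]
  have hnel : ∀ m, lineSet m ∈ ({lineSet m1, lineSet m2, lineSet m3} : Finset _) →
      lineSet m ≠ lineSet l := fun m hm hml => by
    have := hC.five _ hm
    rw [hml, hl3] at this
    omega
  have hdisj : ∀ s ∈ ({lineSet m1, lineSet m2, lineSet m3} : Finset _),
      ∀ t ∈ ({lineSet m1, lineSet m2, lineSet m3} : Finset _), s ≠ t →
      Disjoint ((Y : Set (ℝ × ℝ)) ∩ s) ((Y : Set (ℝ × ℝ)) ∩ t) := fun s hs t ht hst =>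
    Set.disjoint_left.2 fun Q hQ hQt => hC.disjoint s hs t ht hst Q hQ.1 hQ.2 hQt.2
  refine ⟨C, hCY, hC.ne_AC.symm, hC.ne_BC.symm, uC 3,
    ⟨m1, m2, m3, h1, h2, h3, h12, h13, h23, hnel _ (by simp), hnel _ (by simp),
      hnel _ (by simp), ?_, hfive _ (by simp), hfive _ (by simp), hfive _ (by simp),
      hdisj _ (by simp) _ (by simp) h12, hdisj _ (by simp) _ (by simp) h13,
      hdisj _ (by simp) _ (by simp) h23⟩,
    hC.hasMDSeq hX hnm hl3 h1 h2 h3 hl ha haA haB haC h12 h13 h23,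
    hC.swap.hasMDSeq hX hnm hl3 h1 h2 h3 hl hb hbB hbA hbC h12 h13 h23,
    hC.rotate.hasMDSeq hX hnm hl3 h1 h2 h3 hl hc hcC hcA hcB h12 h13 h23, ?_⟩
  · rintro P (rfl | rfl | rfl)
    · exact ⟨uA 0, uA 1, uA 2⟩
    · exact ⟨uB 0, uB 1, uB 2⟩
    · exact ⟨uC 0, uC 1, uC 2⟩
  · ext D
    constructor
    · rintro ⟨hD, hDu⟩
      exact huniq D hD hDu
    · rintro (rfl | rfl | rfl)
      exacts [⟨hA, hAu⟩, ⟨hB, hBu⟩, ⟨hCY, uC 3⟩]
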